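/- Let X and Y be real Banach spaces, let K₁ : X → Y be a bounded linear operator, K₂ : X × X → Y a continuous bilinear map, and 𝒦₁ : Y → X a bounded linear operator. Define K̃₁ = 𝒦₁; K̃₂(φ₁,φ₂) = −𝒦₁(K₂(𝒦₁φ₁, 𝒦₁φ₂)); and for j ≥ 3, K̃_j(φ₁,…,φ_j) = −K̃_{j−1}(K₂(𝒦₁φ₁, 𝒦₁φ₂), K₁(𝒦₁φ₃), …, K₁(𝒦₁φ_j)). Also define nested maps T_n : Xⁿ → X by T₂(x₁,x₂) = 𝒦₁(K₂(x₁,x₂)) and, for n ≥ 3, T_n(x₁,…,x_n) = T_{n−1}( 𝒦₁(K₂(x₁,x₂)), 𝒦₁(K₁ x₃), …, 𝒦₁(K₁ x_n) ). Then for every n ≥ 2 and all φ₁,…,φ_n ∈ Y one has the exact product formula K̃_n(φ₁,…,φ_n) = (−1)^{n−1} · T_n(𝒦₁φ₁, …, 𝒦₁φ_n); that is, K̃_n = (−1)^{n−1} 𝒦₁K₂ (𝒦₁K₂ ⊗ 𝒦₁K₁)(𝒦₁K₂ ⊗ (𝒦₁K₁)^{⊗2}) ⋯ (𝒦₁K₂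 ⊗ (𝒦₁K₁)^{⊗(n−2)}) 𝒦₁^{⊗n}. -/

import Mathlib

/-- The terms of the reduced inverse Born series, with index shift:
`redK K₁ K₂ 𝒦₁ n = K̃_{n+1}`.  Explicitly `K̃₁ = 𝒦₁`,
`K̃₂(φ₁, φ₂) = -𝒦₁(K₂(𝒦₁φ₁, 𝒦₁φ₂))`, and for `j ≥ 3`
`K̃_j(φ₁, …, φ_j) = -K̃_{j-1}(K₂(𝒦₁φ₁, 𝒦₁φ₂), K₁(𝒦₁φ₃), …, K₁(𝒦₁φ_j))`. -/
noncomputable def redK {X Y : Type*} [NormedAddCommGroup X] [NormedSpace ℝ X]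
    [NormedAddCommGroup Y] [NormedSpace ℝ Y]
    (K₁ : X →L[ℝ] Y) (K₂ : X →L[ℝ] X →L[ℝ] Y) (𝒦₁ : Y →L[ℝ] X) :
    (n : ℕ) → (Fin (n + 1) → Y) → X
  | 0, φ => 𝒦₁ (φ 0)
  | 1, φ => -𝒦₁ (K₂ (𝒦₁ (φ 0)) (𝒦₁ (φ 1)))
  | n + 2, φ => -redK K₁ K₂ 𝒦₁ (n + 1)
      (Fin.cons (K₂ (𝒦₁ (φ 0)) (𝒦₁ (φ 1)))
        (fun i : Fin (n + 1) => K₁ (𝒦₁ (φ i.succ.succ))))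

/-- The nested product maps `T_n : Xⁿ → X` (index shift `nestedT m = T_{m+2}`):
`T₂(x₁,x₂) = 𝒦₁K₂(x₁,x₂)` and, for `n ≥ 3`,
`T_n(x₁,…,x_n) = T_{n-1}(𝒦₁K₂(x₁,x₂), 𝒦₁K₁x₃, …, 𝒦₁K₁x_n)`. -/
noncomputable def nestedT {X Y : Type*} [NormedAddCommGroup X] [NormedSpace ℝ X]
    [NormedAddCommGroup Y] [NormedSpace ℝ Y]
    (K₁ : X →L[ℝ] Y) (K₂ : X →L[ℝ] X →L[ℝ] Y) (𝒦₁ : Y →L[ℝ] X) :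
    (m : ℕ) → (Fin (m + 2) → X) → X
  | 0, x => 𝒦₁ (K₂ (x 0) (x 1))
  | m + 1, x => nestedT K₁ K₂ 𝒦₁ m
      (Fin.cons (𝒦₁ (K₂ (x 0) (x 1)))
        (fun i : Fin (m + 1) => 𝒦₁ (K₁ (x i.succ.succ))))

/-- **Proposition 6.5 (explicit product formula for the reduced inverse Born series).**
For every `n ≥ 2` (here `n = m + 2`) and all `φ₁,…,φ_n ∈ Y`,
`K̃_n(φ₁,…,φ_n) = (-1)^{n-1} T_n(𝒦₁φ₁, …, 𝒦₁φ_n)`, i.e.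
`K̃_n = (-1)^{n-1} 𝒦₁K₂ (𝒦₁K₂ ⊗ 𝒦₁K₁)(𝒦₁K₂ ⊗ (𝒦₁K₁)^{⊗2}) ⋯
(𝒦₁K₂ ⊗ (𝒦₁K₁)^{⊗(n-2)}) 𝒦₁^{⊗n}`. -/
theorem stmt_9 {X Y : Type*} [NormedAddCommGroup X] [NormedSpace ℝ X] [CompleteSpace X]
    [NormedAddCommGroup Y] [NormedSpace ℝ Y] [CompleteSpace Y]
    (K₁ : X →L[ℝ] Y) (K₂ : X →L[ℝ] X →L[ℝ] Y) (𝒦₁ : Y →L[ℝ] X) :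
    ∀ (m : ℕ) (φ : Fin (m + 2) → Y),
      redK K₁ K₂ 𝒦₁ (m + 1) φ =
        ((-1 : ℝ) ^ (m + 1)) • nestedT K₁ K₂ 𝒦₁ m (fun i => 𝒦₁ (φ i)) := by
  intro m
  induction m with
  | zero => intro φ; simp [redK, nestedT]
  | succ m ih =>
    intro φ
    have h : (fun i => 𝒦₁ ((Fin.cons (K₂ (𝒦₁ (φ 0)) (𝒦₁ (φ 1)))
          (fun i : Fin (m + 1) => K₁ (𝒦₁ (φ i.succ.succ))) : Fin (m + 2) → Y) i)) =
        (Fin.cons (𝒦₁ (K₂ (𝒦₁ (φ 0)) (𝒦₁ (φ 1))))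
          (fun i : Fin (m + 1) => 𝒦₁ (K₁ (𝒦₁ (φ i.succ.succ)))) : Fin (m + 2) → X) := by
      funext i
      refine Fin.cases ?_ (fun j => ?_) i <;> simp
    rw [redK, nestedT, ih, h, pow_succ (-1 : ℝ) (m + 1), mul_neg_one, neg_smul]
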